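/- Let v be a non-constant word over A = {a,b}. If the last letter of v is a, then μ_v(a) = μ_{v_+}(ba) = ψ(v_+)·ba and μ_v(b) = μ_{v^-}(ab) = ψ(v^-)·ab. If the last letter of v is b, then μ_v(a) = μ_{v^-}(ba) = ψ(v^-)·ba and μ_v(b) = μ_{v_+}(ab) = ψ(v_+)·ab. -/

import Mathlib

namespace Chri

/-- Length of the longest palindromic suffix of `w`. -/
def lpsLen (w : List Bool) : ℕ :=
  ((List.range (w.length + 1)).filter
    (fun l => w.drop (w.length - l) == (w.drop (w.length - l)).reverse)).foldr max 0

/-- Right palindromic closure: the shortest palindrome having `w` as a prefix. -/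
def palClosure (w : List Bool) : List Bool :=
  w ++ (w.take (w.length - lpsLen w)).reverse

/-- The iterated palindromization map ψ. -/
def psi (v : List Bool) : List Bool :=
  v.foldl (fun w x => palClosure (w ++ [x])) []

/-- Apply a substitution (morphism of the free monoid) letter by letter. -/
def applyM (f : Bool → List Bool) (w : List Bool) : List Bool := (w.map f).flatten

/-- μ_x : x ↦ x, y ↦ xy (a = false, b = true). -/
def muL (x : Bool) : List Bool → List Bool :=
  applyM (fun y => if y = x then [x] else [x, y])

/-- λ_a = μ_a; λ_b : a ↦ ab, b ↦ b. -/
def lamL : Bool → List Bool → List Bool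
  | false => applyM (fun y => if y = false then [false] else [false, true])
  | true  => applyM (fun y => if y = true then [true] else [false, true])

/-- μ_{v₁⋯v_n} = μ_{v₁} ∘ ⋯ ∘ μ_{v_n}. -/
def muW : List Bool → List Bool → List Bool
  | [], w => w
  | x :: v, w => muL x (muW v w)

/-- λ_{v₁⋯v_n} = λ_{v₁} ∘ ⋯ ∘ λ_{v_n}. -/
def lamW : List Bool → List Bool → List Bool
  | [], w => w
  | x :: v, w => lamL x (lamW v w)

/-- Christoffel words: the letters and the words aψ(v)b. -/
def IsChristoffel (w : List Bool) : Prop :=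
  w = [false] ∨ w = [true] ∨ ∃ v, w = false :: (psi v ++ [true])

/-- A word is constant if it is a power of a single letter. -/
def IsConstant (v : List Bool) : Prop := ∃ x n, v = List.replicate n x

/-- ₊v : the longest proper suffix of v immediately preceded by the complement of
the first letter of v. -/
def plusV (v : List Bool) : List Bool :=
  (v.dropWhile (fun y => y == v.headD false)).tail

/-- v₊ : the longest proper prefix of v immediately followed by the complement of
the last letter of v. -/
def vPlus (v : List Bool) : List Bool := (plusV v.reverse).reverse

/-- α₀: the length of the first maximal block of `v` (the index). -/
def blockLen (v : List Bool) : ℕ :=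
  (v.takeWhile (fun y => y == v.headD false)).length

/-- The list of lengths of the maximal blocks of equal letters of `v`
(the integral representation (α₀, …, α_n)). -/
def blockLens : List Bool → List ℕ
  | [] => []
  | [_] => [1]
  | x :: y :: v =>
    if x = y then
      match blockLens (y :: v) with
      | [] => [1]
      | n :: ns => (n + 1) :: ns
    else 1 :: blockLens (y :: v)

/-- ext(v) = number of maximal blocks of v. -/
def ext (v : List Bool) : ℕ := (blockLens v).length

/-- π(w): the minimal period of `w` (with π(ε) = 1). -/
noncomputable def minPeriod (w : List Bool) : ℕ :=
  sInf {p | 0 < p ∧ ∀ i, i + p < w.length → w.getD i false = w.getD (i + p) false}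

/-- φ_k : a ↦ a^{k+1} b, b ↦ a^k b. -/
def phi (k : ℕ) : List Bool → List Bool :=
  applyM (fun y => if y = false then List.replicate (k + 1) false ++ [true]
                   else List.replicate k false ++ [true])

/-- φ̂_k : a ↦ a b^k, b ↦ a b^{k+1}. -/
def phiHat (k : ℕ) : List Bool → List Bool :=
  applyM (fun y => if y = false then false :: List.replicate k true
                   else false :: List.replicate (k + 1) true)

attribute [local instance] Classical.propDecidable

/-- The derivative ∂w of a proper Christoffel word w = aψ(v)b of index k:
∂(ab) = a, and otherwise the preimage of w under φ_k (if v starts with a)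
or φ̂_k (if v starts with b). -/
noncomputable def derivC (w : List Bool) : List Bool :=
  if w = [false, true] then [false]
  else if h : ∃ v, v ≠ [] ∧ w = false :: (psi v ++ [true]) then
    if h.choose.headD false = false then Function.invFun (phi (blockLen h.choose)) w
    else Function.invFun (phiHat (blockLen h.choose)) w
  else w

/-- The depth of a Christoffel word: the least d with ∂^d w a single letter. -/
noncomputable def depth (w : List Bool) : ℕ :=
  sInf {d | derivC^[d] w = [false] ∨ derivC^[d] w = [true]}

/-- The height h(v): the least n ≥ 1 such that v_(n) is constant, where
v_(1) = v and v_(n+1) = ₊(v_(n)). -/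
noncomputable def height (v : List Bool) : ℕ :=
  sInf {n | 0 < n ∧ IsConstant (plusV^[n - 1] v)}

/-- Helper computing δ_i from (α_{i-1}, δ_{i-1}) along the remaining exponents. -/
def ruleAux : ℕ → ℕ → List ℕ → List ℕ
  | _, _, [] => []
  | pa, pd, a :: rest =>
    let d := if 1 < a then 1 else if 1 < pa then 0 else 1 - pd
    d :: ruleAux a d rest

/-- The sequence δ₀, δ₁, …, δ_n computed by the recursive rule (δ₀ = 1). -/
def ruleSeq : List ℕ → List ℕ
  | [] => []
  | a :: rest => 1 :: ruleAux a 1 rest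

/-- δ(v) = Σ_{i=0}^n δ_i(v), where additionally δ_n(v) = 1; δ(ε) = 1. -/
def delta (v : List Bool) : ℕ := ((ruleSeq (blockLens v)).dropLast).sum + 1

/-- |u₁|: length of the longest prefix x₀⋯x_i of u with i < n and α₀ = ⋯ = α_i = 1
(and 0 if α₀ > 1 or n = 0). -/
def u1len (u : List Bool) : ℕ :=
  min ((blockLens u).takeWhile (fun n => n == 1)).length ((blockLens u).length - 1)

/-- |u₂|: the symmetric notion for suffixes. -/
def u2len (u : List Bool) : ℕ := u1len u.reverse

/-- The sequence H: H(1) = 0, H(2n) = H(n), H(4n±1) = H(n)+1. -/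
def H : ℕ → ℕ
  | 0 => 0
  | 1 => 0
  | n + 2 =>
    if (n + 2) % 2 = 0 then H ((n + 2) / 2)
    else if (n + 2) % 4 = 1 then H ((n + 2) / 4) + 1
    else H ((n + 3) / 4) + 1
decreasing_by all_goals omega

/-- ⟨w⟩: the word w read as an integer in base 2 (a = 0, b = 1). -/
def wordVal (w : List Bool) : ℕ :=
  w.foldl (fun acc x => 2 * acc + (if x then 1 else 0)) 0

/-- Membership in X^*: w is a concatenation of words of X. -/
def InStar (X : Set (List Bool)) (w : List Bool) : Prop :=
  ∃ l : List (List Bool), (∀ u ∈ l, u ∈ X) ∧ w = l.flatten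

/-- w ∈ x⁺. -/
def PowPos (x : Bool) (w : List Bool) : Prop := ∃ k, 0 < k ∧ w = List.replicate k x

theorem foldr_max_le_iff (l : List ℕ) (n : ℕ) : l.foldr max 0 ≤ n ↔ ∀ a ∈ l, a ≤ n := by
  induction l with
  | nil => simp
  | cons a l ih => simp [ih]

/-- `s` is the longest palindromic suffix of `p ++ s`. -/
def IsLongestPalSuffix (p s : List Bool) : Prop :=
  s.reverse = s ∧ ∀ q t, q ++ t = p ++ s → t.reverse = t → t.length ≤ s.length

theorem exists_longestPalSuffix (w : List Bool) :
    ∃ p s, w = p ++ s ∧ IsLongestPalSuffix p s := by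
  induction w with
  | nil => exact ⟨[], [], rfl, rfl, by simp⟩
  | cons a w ih =>
    by_cases h : (a :: w).reverse = a :: w
    · refine ⟨[], a :: w, rfl, h, fun q t e _ => ?_⟩
      have := congrArg List.length e
      simp at this ⊢
      omega
    · obtain ⟨p, s, rfl, hs, hmax⟩ := ih
      refine ⟨a :: p, s, rfl, hs, fun q t e ht => ?_⟩
      cases q with
      | nil =>
        have e' : t = a :: (p ++ s) := e
        exact absurd (e' ▸ ht) h
      | cons b q => exact hmax q t (List.cons.inj e).2 ht

theorem IsLongestPalSuffix.lpsLen_eq {p s : List Bool} (h : IsLongestPalSuffix p s) :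
    lpsLen (p ++ s) = s.length := by
  apply le_antisymm
  · rw [lpsLen, foldr_max_le_iff]
    intro l hl
    simp only [List.mem_filter, List.mem_range, beq_iff_eq] at hl
    have := h.2 _ _ (List.take_append_drop ((p ++ s).length - l) (p ++ s)) hl.2.symm
    rw [List.length_drop] at this
    omega
  · refine (foldr_max_le_iff _ _).1 le_rfl _ ?_
    simp only [List.mem_filter, List.mem_range, beq_iff_eq]
    simp [h.1]

theorem IsLongestPalSuffix.palClosure_eq {p s : List Bool} (h : IsLongestPalSuffix p s) :
    palClosure (p ++ s) = p ++ s ++ p.reverse := by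
  rw [palClosure, h.lpsLen_eq]
  simp

@[simp] theorem muL_nil (x : Bool) : muL x [] = [] := rfl

theorem muL_cons (x y : Bool) (w : List Bool) :
    muL x (y :: w) = (if y = x then [x] else [x, y]) ++ muL x w := rfl

theorem muL_append (x : Bool) (u w : List Bool) : muL x (u ++ w) = muL x u ++ muL x w := by
  simp [muL, applyM]

/-- `w ↦ μ_x(w) x` commutes with reversal. -/
theorem reverse_muL_append (x : Bool) (w : List Bool) :
    (muL x w ++ [x]).reverse = muL x w.reverse ++ [x] := by
  induction w with
  | nil => rfl
  | cons y w ih =>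
    have ih' : x :: (muL x w).reverse = muL x w.reverse ++ [x] := by simpa using ih
    have ih_append (r : List Bool) : x :: ((muL x w).reverse ++ r) = muL x w.reverse ++ x :: r := by
      rw [← List.cons_append, ih', List.append_assoc, List.singleton_append]
    by_cases h : y = x <;> simp [muL_cons, muL_append, h, ih_append]

theorem cons_reverse_muL (x : Bool) (w : List Bool) :
    x :: (muL x w).reverse = muL x w.reverse ++ [x] := by
  simpa using reverse_muL_append x w

theorem exists_muL_append_eq_cons (x : Bool) (w : List Bool) :
    ∃ t, muL x w ++ [x] = x :: t := by
  cases w with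
  | nil => exact ⟨[], rfl⟩
  | cons y w => by_cases h : y = x <;> simp [muL_cons, h]

theorem muL_injective (x : Bool) : Function.Injective (muL x) := by
  intro u
  induction u with
  | nil =>
    rintro (_ | ⟨y, w⟩) e
    · rfl
    · by_cases h : y = x <;> simp [muL_cons, h] at e
  | cons a u ih =>
    rintro (_ | ⟨b, w⟩) e
    · by_cases h : a = x <;> simp [muL_cons, h] at e
    · have key : ∀ (c : Bool) (u w : List Bool), c ≠ x → muL x u ≠ c :: muL x w := by
        intro c u w hc e
        obtain ⟨t, ht⟩ := exists_muL_append_eq_cons x u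
        rw [e] at ht
        exact hc (List.cons.inj ht).1
      by_cases ha : a = x <;> by_cases hb : b = x <;> simp [muL_cons, ha, hb] at e
      · rw [ha, hb, ih e]
      · exact absurd e (key _ _ _ hb)
      · exact absurd e.symm (key _ _ _ ha)
      · rw [e.1, ih e.2]

/-- A suffix of `μ_x(w) x` starting with `x` is of the form `μ_x(w₂) x`. -/
theorem exists_of_suffix_muL {x : Bool} {w q t : List Bool}
    (e : q ++ x :: t = muL x w ++ [x]) :
    ∃ w₁ w₂, w = w₁ ++ w₂ ∧ x :: t = muL x w₂ ++ [x] := by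
  induction w generalizing q with
  | nil =>
    refine ⟨[], [], rfl, ?_⟩
    cases q <;> simp_all
  | cons y w ih =>
    have extend : (∃ w₁ w₂, w = w₁ ++ w₂ ∧ x :: t = muL x w₂ ++ [x]) →
        ∃ w₁ w₂, y :: w = w₁ ++ w₂ ∧ x :: t = muL x w₂ ++ [x] := by
      rintro ⟨w₁, w₂, rfl, h⟩
      exact ⟨y :: w₁, w₂, rfl, h⟩
    rcases q with _ | ⟨c, q⟩
    · exact ⟨[], y :: w, rfl, e⟩
    · by_cases h : y = x
      · simp [muL_cons, h] at e
        exact extend (ih e.2)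
      · rcases q with _ | ⟨d, q⟩
        · simp [muL_cons, h] at e
          exact absurd e.2.1.symm h
        · simp [muL_cons, h] at e
          exact extend (ih e.2.2)

/-- In `μ_x(w)`, every letter other than `x` is preceded by `x`. -/
theorem eq_append_of_muL_eq {x z : Bool} (hz : z ≠ x) {w q t : List Bool}
    (e : q ++ z :: t = muL x w) : ∃ q₁, q = q₁ ++ [x] := by
  induction w generalizing q with
  | nil => simp at e
  | cons y w ih =>
    rcases q with _ | ⟨c, q⟩
    · by_cases h : y = x <;> simp [muL_cons, h, hz] at e
    · by_cases h : y = x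
      · simp [muL_cons, h] at e
        obtain ⟨q₁, rfl⟩ := ih e.2
        exact ⟨c :: q₁, rfl⟩
      · rcases q with _ | ⟨d, q⟩
        · simp [muL_cons, h] at e
          exact ⟨[], by simp [e.1]⟩
        · simp [muL_cons, h] at e
          obtain ⟨q₁, rfl⟩ := ih e.2.2
          exact ⟨c :: d :: q₁, rfl⟩

/-- Palindromic suffixes of `μ_x(w) x` starting with `x` come from palindromic suffixes of `w`. -/
theorem IsLongestPalSuffix.length_le_muL {p s : List Bool} (h : IsLongestPalSuffix p s)
    {x : Bool} {q t : List Bool} (e : q ++ x :: t = muL x (p ++ s) ++ [x])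
    (ht : (x :: t).reverse = x :: t) : (x :: t).length ≤ (muL x s ++ [x]).length := by
  obtain ⟨w₁, w₂, hw, h₂⟩ := exists_of_suffix_muL e
  rw [h₂] at ht ⊢
  rw [reverse_muL_append] at ht
  have hpal := muL_injective x (List.append_cancel_right ht)
  have hle := h.2 _ _ hw.symm hpal
  obtain ⟨r, rfl⟩ : w₂ <:+ s :=
    List.suffix_of_suffix_length_le ⟨w₁, hw.symm⟩ ⟨p, rfl⟩ hle
  simp [muL_append]

/-- A nonempty palindrome ending in `z` starts with `z`. -/
theorem exists_cons_of_palindrome {q t w : List Bool} {z : Bool} (e : q ++ t = w ++ [z])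
    (ht : t.reverse = t) (hne : t ≠ []) : ∃ t', t = z :: t' := by
  obtain ⟨t₁, c, rfl⟩ := List.eq_nil_or_concat t |>.resolve_left hne
  have hc : c = z := by
    rw [List.concat_eq_append, ← List.append_assoc] at e
    simpa using (List.append_inj' e rfl).2
  subst hc
  refine ⟨t₁.reverse, ?_⟩
  rw [← ht]
  simp

theorem IsLongestPalSuffix.ne_nil {p s w : List Bool} {z : Bool} (h : IsLongestPalSuffix p s)
    (hw : w ++ [z] = p ++ s) : s ≠ [] := by
  rintro rfl
  simpa using h.2 w [z] hw rfl

theorem palClosure_muL (x z : Bool) (w : List Bool) :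
    palClosure (muL x w ++ [x, z]) = muL x (palClosure (w ++ [z])) ++ [x] := by
  obtain ⟨p, s, hw, h⟩ := exists_longestPalSuffix (w ++ [z])
  rw [hw, h.palClosure_eq]
  have hpal : (muL x s ++ [x]).reverse = muL x s ++ [x] := by rw [reverse_muL_append, h.1]
  by_cases hz : z = x
  · subst hz
    have e : muL z w ++ [z, z] = muL z p ++ (muL z s ++ [z]) := by
      rw [← List.append_assoc, ← muL_append, ← hw]
      simp [muL_append, muL_cons]
    have h' : IsLongestPalSuffix (muL z p) (muL z s ++ [z]) := by
      refine ⟨hpal, fun q t eq ht => ?_⟩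
      rcases eq_or_ne t [] with rfl | hne
      · simp
      · rw [← List.append_assoc, ← muL_append] at eq
        obtain ⟨t', rfl⟩ := exists_cons_of_palindrome eq ht hne
        exact h.length_le_muL eq ht
    rw [e, h'.palClosure_eq]
    simp [muL_append, cons_reverse_muL]
  · have e : muL x w ++ [x, z] = muL x (p ++ s) := by
      rw [← hw]
      simp [muL_append, muL_cons, hz]
    obtain ⟨s₁, rfl⟩ := exists_cons_of_palindrome hw.symm h.1 (h.ne_nil hw)
    have hs : muL x (z :: s₁) = x :: z :: muL x s₁ := by simp [muL_cons, hz]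
    have hpal' : (z :: muL x s₁).reverse = z :: muL x s₁ := by
      rw [hs, List.cons_append, List.reverse_cons, List.reverse_append, List.reverse_singleton,
        List.singleton_append, List.cons_append, List.cons_inj_right] at hpal
      exact List.append_cancel_right hpal
    have h' : IsLongestPalSuffix (muL x p ++ [x]) (z :: muL x s₁) := by
      refine ⟨hpal', fun q t eq ht => ?_⟩
      have eq' : q ++ t = muL x (p ++ z :: s₁) := by simp [eq, muL_append, hs]
      rcases eq_or_ne t [] with rfl | hne
      · simp
      · have eq'' : q ++ t = (muL x w ++ [x]) ++ [z] := by simp [eq', ← e]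
        obtain ⟨t', rfl⟩ := exists_cons_of_palindrome eq'' ht hne
        obtain ⟨q₁, rfl⟩ := eq_append_of_muL_eq hz eq'
        have := h.length_le_muL (x := x) (q := q₁) (t := z :: t' ++ [x])
          (by rw [← eq']; simp) (by
            rw [List.reverse_cons, List.reverse_append, ht]
            rfl)
        simpa [hs] using this
    have e' : muL x (p ++ z :: s₁) = muL x p ++ [x] ++ z :: muL x s₁ := by
      simp [muL_append, hs]
    rw [e, e', h'.palClosure_eq]
    simp [muL_append, muL_cons, hz, cons_reverse_muL]

theorem psi_append_singleton (u : List Bool) (z : Bool) :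
    psi (u ++ [z]) = palClosure (psi u ++ [z]) := by
  simp [psi]

/-- Justin's formula, for a single letter: `ψ(xu) = μ_x(ψ(u)) x`. -/
theorem psi_cons (x : Bool) (u : List Bool) : psi (x :: u) = muL x (psi u) ++ [x] := by
  induction u using List.reverseRecOn with
  | nil => cases x <;> decide
  | append_singleton u z ih =>
    rw [← List.cons_append, psi_append_singleton, ih, psi_append_singleton, ← palClosure_muL]
    simp

theorem muW_pair (u : List Bool) {x y : Bool} (h : x ≠ y) :
    muW u [x, y] = psi u ++ [x, y] := by
  induction u with
  | nil => rfl
  | cons z u ih =>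
    rw [muW, ih, psi_cons, muL_append, List.append_assoc]
    congr 1
    clear ih
    revert x y z
    decide

theorem muW_append (u v w : List Bool) : muW (u ++ v) w = muW u (muW v w) := by
  induction u with
  | nil => rfl
  | cons x u ih => simp [muW, ih]

theorem muW_replicate_self (x : Bool) (k : ℕ) : muW (List.replicate k x) [x] = [x] := by
  induction k with
  | zero => rfl
  | succ k ih => simp [List.replicate_succ, muW, ih, muL_cons]

/-- A non-constant word ending in `x` is `v₊ · y · x ^ k` with `y ≠ x`. -/
theorem exists_eq_vPlus_append {v : List Bool} (hv : ¬ IsConstant v) {x : Bool}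
    (hx : v.getLast? = some x) : ∃ k, v = vPlus v ++ (!x) :: List.replicate k x := by
  have hhead : v.reverse.headD false = x := by
    rw [List.headD_eq_head?_getD, List.head?_reverse, hx, Option.getD_some]
  have hsplit := List.takeWhile_append_dropWhile (p := fun y => y == x) (l := v.reverse)
  have htake : v.reverse.takeWhile (fun y => y == x) =
      List.replicate (v.reverse.takeWhile (fun y => y == x)).length x :=
    List.eq_replicate_iff.2 ⟨rfl, fun b hb => by simpa using List.mem_takeWhile_imp hb⟩
  rw [htake] at hsplit
  generalize (v.reverse.takeWhile (fun y => y == x)).length = k at hsplit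
  rcases hd : v.reverse.dropWhile (fun y => y == x) with _ | ⟨c, r⟩
  · rw [hd, List.append_nil] at hsplit
    refine absurd ⟨x, k, ?_⟩ hv
    rw [← List.reverse_reverse v, ← hsplit, List.reverse_replicate]
  · have hc : c = !x := by
      have := List.head_dropWhile_not (fun y => y == x) (l := v.reverse) (by simp [hd])
      simp only [hd, List.head_cons] at this
      revert this
      cases c <;> cases x <;> simp
    refine ⟨k, ?_⟩
    rw [vPlus, plusV, hhead, hd, List.tail_cons, ← hc]
    rw [hd] at hsplit
    rw [← List.reverse_inj, ← hsplit]
    simp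

theorem muW_self_of_getLast? {v : List Bool} (hv : ¬ IsConstant v) {x : Bool}
    (hx : v.getLast? = some x) : muW v [x] = muW (vPlus v) [!x, x] := by
  obtain ⟨k, hk⟩ := exists_eq_vPlus_append hv hx
  conv_lhs => rw [hk, muW_append, muW, muW_replicate_self]
  cases x <;> rfl

theorem muW_not_of_getLast? {v : List Bool} {x : Bool} (hx : v.getLast? = some x) :
    muW v [!x] = muW v.dropLast [x, !x] := by
  conv_lhs => rw [← List.dropLast_append_getLast? x hx, muW_append]
  cases x <;> rfl

/-- the images of the letters under μ_v, for v non-constant. -/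
theorem muW_letters (v : List Bool) (hv : ¬ IsConstant v) :
    (v.getLast? = some false →
      muW v [false] = muW (vPlus v) [true, false] ∧
      muW (vPlus v) [true, false] = psi (vPlus v) ++ [true, false] ∧
      muW v [true] = muW v.dropLast [false, true] ∧
      muW v.dropLast [false, true] = psi v.dropLast ++ [false, true]) ∧
    (v.getLast? = some true →
      muW v [false] = muW v.dropLast [true, false] ∧
      muW v.dropLast [true, false] = psi v.dropLast ++ [true, false] ∧
      muW v [true] = muW (vPlus v) [false, true] ∧
      muW (vPlus v) [false, true] = psi (vPlus v) ++ [false, true]) := by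
  refine ⟨fun h => ⟨muW_self_of_getLast? hv h, muW_pair _ (by decide), muW_not_of_getLast? h,
    muW_pair _ (by decide)⟩, fun h => ⟨muW_not_of_getLast? h, muW_pair _ (by decide),
    muW_self_of_getLast? hv h, muW_pair _ (by decide)⟩⟩

end Chri
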